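/- For every OPT-free SPARQL graph pattern P (built from triple patterns using only AND, UNION, and FILTER), there exists a pattern Q in strong UNION normal form such that P ≡ Q. -/

import Mathlib

namespace SPARQL

/-- Kinds of RDF constants: IRIs, blank nodes, literals. -/
inductive Kind : Type
  | iri | blank | lit
deriving DecidableEq

/-- The countably infinite set `U` of constants, partitioned into the three
infinite sets of IRIs `I` (kind `iri`), blank nodes `B` (kind `blank`) and
literals `L` (kind `lit`). -/
abbrev Const := Kind × ℕ

/-- The countably infinite set `V` of variables (disjoint from `U`). -/
abbrev Var := ℕ

/-- A mapping: a partial function from variables to constants with finite domain. -/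
structure Mapping where
  toFun : Var → Option Const
  finite : {x : Var | toFun x ≠ none}.Finite

/-- The domain of a mapping. -/
def Mapping.dom (μ : Mapping) : Set Var := {x | μ.toFun x ≠ none}

/-- Two mappings are compatible if they agree on the intersection of their domains. -/
def Compatible (μ₁ μ₂ : Mapping) : Prop :=
  ∀ x ∈ μ₁.dom ∩ μ₂.dom, μ₁.toFun x = μ₂.toFun x

/-- Union of two mappings (preferring the first one where both are defined). -/
def Mapping.union (μ₁ μ₂ : Mapping) : Mapping where
  toFun := fun x => match μ₁.toFun x with
    | some u => some u
    | none => μ₂.toFun x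
  finite := by
    apply (μ₁.finite.union μ₂.finite).subset
    intro x hx
    simp only [Set.mem_setOf_eq] at hx
    simp only [Set.mem_union, Set.mem_setOf_eq]
    by_cases h1 : μ₁.toFun x = none
    · right; intro h2; apply hx; simp [h1, h2]
    · left; exact h1

/-- A term: either a constant or a variable. -/
inductive Term : Type
  | const : Const → Term
  | var : Var → Term

/-- A triple pattern. -/
abbrev TriplePat := Term × Term × Term

/-- An RDF graph: a finite set of triples of constants. -/
abbrev Graph := Finset (Const × Const × Const)

/-- Variables of a term. -/
def Term.vars : Term → Set Var
  | .const _ => ∅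
  | .var x => {x}

/-- Variables of a triple pattern. -/
def tripleVars (t : TriplePat) : Set Var := t.1.vars ∪ t.2.1.vars ∪ t.2.2.vars

/-- Apply a mapping to a term. -/
def Term.app (μ : Mapping) : Term → Option Const
  | .const c => some c
  | .var x => μ.toFun x

/-- Three truth values: true, false, error. -/
inductive TV : Type
  | t | f | e
deriving DecidableEq

/-- Kleene negation. -/
def TV.neg : TV → TV
  | .t => .f
  | .f => .t
  | .e => .e

/-- Kleene conjunction. -/
def TV.and : TV → TV → TV
  | .f, _ => .f
  | _, .f => .f
  | .t, .t => .t
  | _, _ => .e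

/-- Kleene disjunction. -/
def TV.or : TV → TV → TV
  | .t, _ => .t
  | _, .t => .t
  | .f, .f => .f
  | _, _ => .e

/-- Constraints: Boolean combinations of the atomic constraints
`bound(?x)`, `?x = c`, `?x = ?y`, `isIRI(?x)`, `isBlank(?x)`, `isLiteral(?x)`. -/
inductive Constraint : Type
  | bound : Var → Constraint
  | eqC : Var → Const → Constraint
  | eqV : Var → Var → Constraint
  | isIRI : Var → Constraint
  | isBlank : Var → Constraint
  | isLiteral : Var → Constraint
  | and : Constraint → Constraint → Constraint
  | or : Constraint → Constraint → Constraint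
  | not : Constraint → Constraint

/-- Three-valued evaluation of a constraint on a mapping. -/
def Constraint.eval (μ : Mapping) : Constraint → TV
  | .bound x => match μ.toFun x with
      | some _ => .t
      | none => .f
  | .eqC x c => match μ.toFun x with
      | some u => if u = c then .t else .f
      | none => .e
  | .eqV x y => match μ.toFun x, μ.toFun y with
      | some u, some v => if u = v then .t else .f
      | _, _ => .e
  | .isIRI x => match μ.toFun x with
      | some u => if u.1 = Kind.iri then .t else .f
      | none => .e
  | .isBlank x => match μ.toFun x with
      | some u => if u.1 = Kind.blank then .t else .f
      | none => .e
  | .isLiteral x => match μ.toFun x with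
      | some u => if u.1 = Kind.lit then .t else .f
      | none => .e
  | .and C D => (C.eval μ).and (D.eval μ)
  | .or C D => (C.eval μ).or (D.eval μ)
  | .not C => (C.eval μ).neg

/-- SPARQL graph patterns. -/
inductive Pattern : Type
  | triple : TriplePat → Pattern
  | and : Pattern → Pattern → Pattern
  | union : Pattern → Pattern → Pattern
  | opt : Pattern → Pattern → Pattern
  | filter : Pattern → Constraint → Pattern

/-- `μ(t) ∈ G` for a triple pattern `t`. -/
def tripleMatch (μ : Mapping) (t : TriplePat) (G : Graph) : Prop :=
  ∃ s p o : Const, t.1.app μ = some s ∧ t.2.1.app μ = some p ∧ t.2.2.app μ = some o ∧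
    (s, p, o) ∈ G

/-- Evaluation of a pattern on an RDF graph: a set of mappings. -/
def Pattern.eval (G : Graph) : Pattern → Set Mapping
  | .triple t => {μ | μ.dom = tripleVars t ∧ tripleMatch μ t G}
  | .and P₁ P₂ =>
      {μ | ∃ μ₁ ∈ P₁.eval G, ∃ μ₂ ∈ P₂.eval G, Compatible μ₁ μ₂ ∧ μ = μ₁.union μ₂}
  | .union P₁ P₂ => P₁.eval G ∪ P₂.eval G
  | .opt P₁ P₂ =>
      {μ | ∃ μ₁ ∈ P₁.eval G, ∃ μ₂ ∈ P₂.eval G, Compatible μ₁ μ₂ ∧ μ = μ₁.union μ₂} ∪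
      {μ₁ ∈ P₁.eval G | ∀ μ₂ ∈ P₂.eval G, ¬ Compatible μ₁ μ₂}
  | .filter P C => {μ ∈ P.eval G | C.eval μ = TV.t}

/-- A pattern is monotonic if enlarging the graph enlarges the answer set. -/
def Monotonic (P : Pattern) : Prop :=
  ∀ G₁ G₂ : Graph, G₁ ⊆ G₂ → P.eval G₁ ⊆ P.eval G₂

/-- Subsumption of mappings: `μ₁ ⊑ μ₂`. -/
def Mapping.Sub (μ₁ μ₂ : Mapping) : Prop :=
  μ₁.dom ⊆ μ₂.dom ∧ ∀ x ∈ μ₁.dom, μ₁.toFun x = μ₂.toFun x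

/-- Subsumption of sets of mappings: `Ω₁ ⊑ Ω₂`. -/
def SetSub (Ω₁ Ω₂ : Set Mapping) : Prop :=
  ∀ μ₁ ∈ Ω₁, ∃ μ₂ ∈ Ω₂, μ₁.Sub μ₂

/-- A pattern is weakly monotonic if enlarging the graph subsumes the old answers. -/
def WeaklyMonotonic (P : Pattern) : Prop :=
  ∀ G₁ G₂ : Graph, G₁ ⊆ G₂ → SetSub (P.eval G₁) (P.eval G₂)

/-- Variables occurring in the triple patterns of a pattern. -/
def Pattern.vars : Pattern → Set Var
  | .triple t => tripleVars t
  | .and P Q => P.vars ∪ Q.vars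
  | .union P Q => P.vars ∪ Q.vars
  | .opt P Q => P.vars ∪ Q.vars
  | .filter P _ => P.vars


/-- Atomic constraints. -/
def atomicC : Constraint → Prop
  | .bound _ => True
  | .eqC _ _ => True
  | .eqV _ _ => True
  | .isIRI _ => True
  | .isBlank _ => True
  | .isLiteral _ => True
  | _ => False

/-- A constraint that is atomic or the negation of an atomic constraint. -/
def litC (C : Constraint) : Prop := atomicC C ∨ ∃ D, atomicC D ∧ C = D.not

/-- AF-patterns (built with AND and FILTER only) all of whose FILTER constraints
are atomic or negations of atomic constraints. -/
def strongAF : Pattern → Prop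
  | .triple _ => True
  | .and P Q => strongAF P ∧ strongAF Q
  | .filter P C => strongAF P ∧ litC C
  | _ => False

/-- Strong UNION normal form: a UNION of such AF-patterns. -/
def strongUNF : Pattern → Prop
  | .union P Q => strongUNF P ∧ strongUNF Q
  | P => strongAF P

/-- OPT-free patterns (built from triple patterns using only AND, UNION, FILTER). -/
def optFree : Pattern → Prop
  | .triple _ => True
  | .and P Q => optFree P ∧ optFree Q
  | .union P Q => optFree P ∧ optFree Q
  | .opt _ _ => False
  | .filter P _ => optFree P

theorem unf_of_af {P : Pattern} (h : strongAF P) : strongUNF P := by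
  cases P <;> simp_all [strongAF, strongUNF]

theorem unf_ind {M : Pattern → Prop} (haf : ∀ P, strongAF P → M P)
    (hu : ∀ P Q, strongUNF P → strongUNF Q → M P → M Q → M (.union P Q)) :
    ∀ P, strongUNF P → M P := by
  intro P
  induction P with
  | union P Q ihP ihQ => intro h; exact hu P Q h.1 h.2 (ihP h.1) (ihQ h.2)
  | triple t => intro h; exact haf _ h
  | and P Q _ _ => intro h; exact haf _ h
  | opt P Q _ _ => intro h; exact haf _ h
  | filter P C _ => intro h; exact haf _ h

theorem unf_and (P : Pattern) (hP : strongUNF P) : ∀ Q, strongUNF Q →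
    ∃ R : Pattern, strongUNF R ∧ ∀ G : Graph, (Pattern.and P Q).eval G = R.eval G := by
  refine unf_ind (M := fun P => ∀ Q, strongUNF Q →
    ∃ R : Pattern, strongUNF R ∧ ∀ G : Graph, (Pattern.and P Q).eval G = R.eval G) ?_ ?_ P hP
  · intro P hP
    apply unf_ind
    · intro Q hQ
      exact ⟨.and P Q, ⟨hP, hQ⟩, fun _ => rfl⟩
    · rintro Q₁ Q₂ - - ⟨R₁, h₁, e₁⟩ ⟨R₂, h₂, e₂⟩
      refine ⟨.union R₁ R₂, ⟨h₁, h₂⟩, fun G => ?_⟩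
      rw [Pattern.eval, Pattern.eval, Pattern.eval, ← e₁, ← e₂]
      ext μ
      simp only [Pattern.eval, Set.mem_union, Set.mem_setOf_eq]
      grind
  · intro P₁ P₂ _ _ i₁ i₂ Q hQ
    obtain ⟨R₁, h₁, e₁⟩ := i₁ Q hQ
    obtain ⟨R₂, h₂, e₂⟩ := i₂ Q hQ
    refine ⟨.union R₁ R₂, ⟨h₁, h₂⟩, fun G => ?_⟩
    rw [Pattern.eval, Pattern.eval, Pattern.eval, ← e₁, ← e₂]
    ext μ
    simp only [Pattern.eval, Set.mem_union, Set.mem_setOf_eq]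
    grind

theorem unf_lit (C : Constraint) (hC : litC C) : ∀ P, strongUNF P →
    ∃ R : Pattern, strongUNF R ∧ ∀ G : Graph, (Pattern.filter P C).eval G = R.eval G := by
  apply unf_ind
  · intro P hP
    exact ⟨.filter P C, ⟨hP, hC⟩, fun _ => rfl⟩
  · rintro Q₁ Q₂ - - ⟨R₁, h₁, e₁⟩ ⟨R₂, h₂, e₂⟩
    refine ⟨.union R₁ R₂, ⟨h₁, h₂⟩, fun G => ?_⟩
    rw [Pattern.eval, Pattern.eval, Pattern.eval, ← e₁, ← e₂]
    ext μ
    simp only [Pattern.eval, Set.mem_union, Set.mem_setOf_eq]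
    grind

/-- Constraints that can be eliminated over normal forms. -/
def Good (C : Constraint) : Prop := ∀ P, strongUNF P →
    ∃ R : Pattern, strongUNF R ∧ ∀ G : Graph, (Pattern.filter P C).eval G = R.eval G

theorem good_congr {C D : Constraint} (h : ∀ μ, C.eval μ = .t ↔ D.eval μ = .t) (hC : Good C) :
    Good D := by
  intro P hP
  obtain ⟨R, hR, e⟩ := hC P hP
  refine ⟨R, hR, fun G => ?_⟩
  rw [← e]
  simp only [Pattern.eval, h]

theorem tv_and (a b : TV) : a.and b = .t ↔ a = .t ∧ b = .t := by
  cases a <;> cases b <;> simp [TV.and]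

theorem tv_or (a b : TV) : a.or b = .t ↔ a = .t ∨ b = .t := by
  cases a <;> cases b <;> simp [TV.or]

theorem tv_nand (a b : TV) : (a.and b).neg = a.neg.or b.neg := by
  cases a <;> cases b <;> rfl

theorem tv_nor (a b : TV) : (a.or b).neg = a.neg.and b.neg := by
  cases a <;> cases b <;> rfl

theorem tv_nn (a : TV) : a.neg.neg = a := by
  cases a <;> rfl

theorem good_and {C D : Constraint} (hC : Good C) (hD : Good D) : Good (.and C D) := by
  intro P hP
  obtain ⟨R, hR, e⟩ := hC P hP
  obtain ⟨S, hS, e'⟩ := hD R hR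
  refine ⟨S, hS, fun G => ?_⟩
  rw [← e', Pattern.eval, Pattern.eval, ← e]
  ext μ
  simp only [Pattern.eval, Constraint.eval, tv_and, Set.mem_setOf_eq]
  tauto

theorem good_or {C D : Constraint} (hC : Good C) (hD : Good D) : Good (.or C D) := by
  intro P hP
  obtain ⟨R, hR, e⟩ := hC P hP
  obtain ⟨S, hS, e'⟩ := hD P hP
  refine ⟨.union R S, ⟨hR, hS⟩, fun G => ?_⟩
  rw [Pattern.eval, Pattern.eval, ← e, ← e']
  ext μ
  simp only [Pattern.eval, Constraint.eval, tv_or, Set.mem_setOf_eq, Set.mem_union]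
  tauto

theorem good_atom {C : Constraint} (h : atomicC C) : Good C ∧ Good C.not :=
  ⟨unf_lit C (Or.inl h), unf_lit _ (Or.inr ⟨C, h, rfl⟩)⟩

theorem good_all (C : Constraint) : Good C ∧ Good C.not := by
  induction C with
  | and C D hC hD =>
    refine ⟨good_and hC.1 hD.1, good_congr (fun μ => ?_) (good_or hC.2 hD.2)⟩
    simp only [Constraint.eval, tv_nand]
  | or C D hC hD =>
    refine ⟨good_or hC.1 hD.1, good_congr (fun μ => ?_) (good_and hC.2 hD.2)⟩
    simp only [Constraint.eval, tv_nor]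
  | not C hC =>
    refine ⟨hC.2, good_congr (fun μ => ?_) hC.1⟩
    simp only [Constraint.eval, tv_nn]
  | _ => exact good_atom trivial

/-- every OPT-free pattern is equivalent to a pattern in strong
UNION normal form. -/
theorem optFree_exists_strongUNF (P : Pattern) (h : optFree P) :
    ∃ Q : Pattern, strongUNF Q ∧ ∀ G : Graph, P.eval G = Q.eval G := by
  induction P with
  | triple t => exact ⟨.triple t, trivial, fun _ => rfl⟩
  | and P Q ihP ihQ =>
    obtain ⟨R, hR, e⟩ := ihP h.1
    obtain ⟨S, hS, e'⟩ := ihQ h.2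
    obtain ⟨T, hT, e''⟩ := unf_and R hR S hS
    refine ⟨T, hT, fun G => ?_⟩
    rw [← e'']
    simp only [Pattern.eval, e, e']
  | union P Q ihP ihQ =>
    obtain ⟨R, hR, e⟩ := ihP h.1
    obtain ⟨S, hS, e'⟩ := ihQ h.2
    refine ⟨.union R S, ⟨hR, hS⟩, fun G => ?_⟩
    simp only [Pattern.eval, e, e']
  | opt P Q _ _ => exact h.elim
  | filter P C ih =>
    obtain ⟨R, hR, e⟩ := ih h
    obtain ⟨T, hT, e''⟩ := (good_all C).1 R hR
    refine ⟨T, hT, fun G => ?_⟩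
    rw [← e'']
    simp only [Pattern.eval, e]

end SPARQL
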